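/- arXiv:1902.04736 — 3 statements merged into one kernel-verified Lean document; each statement's English description precedes it below -/
import Mathlib

section
/- Let q be a prime power and n a positive integer, and set Ω := Ω_q(x^n − 1). Then 2·Ω ≤ n + gcd(n, q − 1); in particular Ω ≤ n. -/
open Polynomial

/-- The number of distinct monic irreducible polynomials over `F` dividing `X^n - 1`. -/
noncomputable def OmegaQ (F : Type*) [Field F] (n : ℕ) : ℕ :=
  {g : F[X] | g.Monic ∧ Irreducible g ∧ g ∣ X ^ n - 1}.ncard

/-- The degrees of finitely many distinct monic irreducible divisors of a nonzero polynomial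
add up to at most its degree. -/
theorem sum_natDegree_le_of_monic_irreducible_dvd {F : Type*} [Field F] {p : F[X]} (hp : p ≠ 0)
    (T : Finset F[X]) (hT : ∀ g ∈ T, g.Monic ∧ Irreducible g ∧ g ∣ p) :
    ∑ g ∈ T, g.natDegree ≤ p.natDegree := by
  rw [← natDegree_prod_of_monic T (fun g => g) fun g hg => (hT g hg).1]
  refine natDegree_le_of_dvd (Finset.prod_dvd_of_coprime ?_ fun g hg => (hT g hg).2.2) hp
  intro g hg h hh hne
  refine ((hT g hg).2.1.coprime_iff_not_dvd).2 fun hdvd => hne ?_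
  exact eq_of_monic_of_associated (hT g hg).1 (hT h hh).1
    ((hT g hg).2.1.associated_of_dvd (hT h hh).2.1 hdvd)

/-- Over a finite field, `X ^ n - 1` has at most `gcd(n, #F - 1)` monic divisors of degree one. -/
theorem card_monic_linear_dvd_X_pow_sub_one_le {F : Type*} [Field F] [Fintype F] {n : ℕ}
    (hn : 0 < n) (T : Finset F[X])
    (hT : ∀ g ∈ T, g.Monic ∧ g.natDegree = 1 ∧ g ∣ X ^ n - 1) :
    T.card ≤ n.gcd (Fintype.card F - 1) := by
  classical
  have hd : 0 < n.gcd (Fintype.card F - 1) := Nat.gcd_pos_of_pos_left _ hn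
  refine le_trans ?_ ((Multiset.toFinset_card_le _).trans
    (card_nthRoots (n.gcd (Fintype.card F - 1)) (1 : F)))
  have hform : ∀ g ∈ T, g = X + C (g.coeff 0) := fun g hg =>
    (hT g hg).1.eq_X_add_C (hT g hg).2.1
  refine Finset.card_le_card_of_injOn (fun g => -g.coeff 0) ?_ ?_
  · intro g hg
    have hroot : (-g.coeff 0) ^ n = 1 := by
      have hz : g.eval (-g.coeff 0) = 0 := by
        conv_lhs => rw [hform g hg]
        simp
      have := eval_eq_zero_of_dvd_of_eval_eq_zero (hT g hg).2.2 hz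
      simpa [sub_eq_zero] using this
    have hne : -g.coeff 0 ≠ 0 := by
      intro h0
      rw [h0, zero_pow hn.ne'] at hroot
      exact zero_ne_one hroot
    simp only [Finset.mem_coe, Multiset.mem_toFinset, mem_nthRoots hd]
    exact pow_gcd_eq_one.2 ⟨hroot, FiniteField.pow_card_sub_one_eq_one _ hne⟩
  · intro g hg h hh heq
    rw [hform g hg, hform h hh, neg_injective heq]

theorem two_mul_OmegaQ_le (q n : ℕ) (hn : 0 < n)
    (F : Type) [Field F] [Fintype F] (hF : Fintype.card F = q) :
    2 * OmegaQ F n ≤ n + Nat.gcd n (q - 1) ∧ OmegaQ F n ≤ n := by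
  classical
  subst hF
  have hp : (X ^ n - 1 : F[X]) ≠ 0 := X_pow_sub_C_ne_zero hn 1
  have hfin : {g : F[X] | g.Monic ∧ Irreducible g ∧ g ∣ X ^ n - 1}.Finite := by
    refine (UniqueFactorizationMonoid.normalizedFactors
      (X ^ n - 1 : F[X])).toFinset.finite_toSet.subset ?_
    rintro g ⟨hm, hi, hdvd⟩
    exact Multiset.mem_toFinset.2 <| (UniqueFactorizationMonoid.mem_normalizedFactors_iff' hp).2
      ⟨hi, hm.normalize_eq_self, hdvd⟩
  have hT : ∀ g ∈ hfin.toFinset, g.Monic ∧ Irreducible g ∧ g ∣ X ^ n - 1 := fun g hg =>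
    hfin.mem_toFinset.1 hg
  have hsum := sum_natDegree_le_of_monic_irreducible_dvd hp hfin.toFinset hT
  have hdeg : (X ^ n - 1 : F[X]).natDegree = n := natDegree_X_pow_sub_C (r := (1 : F))
  have hlin := card_monic_linear_dvd_X_pow_sub_one_le hn
    (hfin.toFinset.filter fun g => g.natDegree = 1) fun g hg => by
      obtain ⟨hg, h1⟩ := Finset.mem_filter.1 hg
      exact ⟨(hT g hg).1, h1, (hT g hg).2.2⟩
  have hcount : 2 * hfin.toFinset.card ≤
      ∑ g ∈ hfin.toFinset, g.natDegree +
        (hfin.toFinset.filter fun g => g.natDegree = 1).card := by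
    rw [Finset.card_filter, ← Finset.sum_add_distrib, mul_comm, ← smul_eq_mul]
    refine Finset.card_nsmul_le_sum _ _ _ fun g hg => ?_
    have := (hT g hg).2.1.natDegree_pos
    split_ifs <;> omega
  have hgcd := Nat.gcd_le_left (Fintype.card F - 1) hn
  rw [OmegaQ, Set.ncard_eq_toFinset_card _ hfin]
  omega
end

section
/- For every positive integer N, 2^(ω(N)) < 11.25 · N^(1/5), where N^(1/5) denotes the real fifth root of N. -/
/-- The product of `c / p` over `p ∈ S` is at most that over `p ∈ T` if `T` consists of numbers
`≤ c` and the elements of `S` outside `T` are `≥ c`; stated without division. -/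
theorem prod_const_mul_prod_le {S T : Finset ℕ} {c : ℕ} (hT : ∀ p ∈ T, p ≤ c)
    (hS : ∀ p ∈ S, p ∉ T → c ≤ p) :
    c ^ S.card * ∏ p ∈ T, p ≤ c ^ T.card * ∏ p ∈ S, p := by
  have h₁ : ∏ _p ∈ S \ T, c ≤ ∏ p ∈ S \ T, p :=
    Finset.prod_le_prod' fun p hp => hS p (Finset.mem_sdiff.1 hp).1 (Finset.mem_sdiff.1 hp).2
  have h₂ : ∏ p ∈ T \ S, p ≤ ∏ _p ∈ T \ S, c :=
    Finset.prod_le_prod' fun p hp => hT p (Finset.mem_sdiff.1 hp).1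
  rw [← Finset.prod_const, ← Finset.prod_const, ← Finset.prod_inter_mul_prod_sdiff S T (fun _ => c),
    ← Finset.prod_inter_mul_prod_sdiff T S (fun _ => c),
    ← Finset.prod_inter_mul_prod_sdiff S T (fun p => p),
    ← Finset.prod_inter_mul_prod_sdiff T S (fun p => p), Finset.inter_comm T S]
  calc _ = (∏ _p ∈ S ∩ T, c) * (∏ p ∈ S ∩ T, p) * ((∏ _p ∈ S \ T, c) * ∏ p ∈ T \ S, p) := by ring
    _ ≤ (∏ _p ∈ S ∩ T, c) * (∏ p ∈ S ∩ T, p) * ((∏ p ∈ S \ T, p) * ∏ _p ∈ T \ S, c) := by gcongr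
    _ = _ := by ring

/-- The ratio `32 ^ ω N / N` is largest when `N` is the primorial of `31`, which has `11` prime
factors. -/
theorem pow_card_primeFactors_mul_le {N : ℕ} (hN : 0 < N) :
    32 ^ N.primeFactors.card * 200560490130 ≤ 32 ^ 11 * N := by
  have hprod : ∏ p ∈ (Finset.range 32).filter Nat.Prime, p = 200560490130 := by decide
  have hcard : ((Finset.range 32).filter Nat.Prime).card = 11 := by decide
  have h := prod_const_mul_prod_le (S := N.primeFactors)
    (T := (Finset.range 32).filter Nat.Prime) (c := 32)
    (fun p hp => (Finset.mem_range.1 (Finset.mem_filter.1 hp).1).le)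
    (fun p hp hpT => by
      by_contra! hlt
      exact hpT (Finset.mem_filter.2
        ⟨Finset.mem_range.2 hlt, Nat.prime_of_mem_primeFactors hp⟩))
  rw [hprod, hcard] at h
  exact h.trans (Nat.mul_le_mul_left _ (Nat.le_of_dvd hN (Nat.prod_primeFactors_dvd N)))

theorem two_pow_omega_lt (N : ℕ) (hN : 0 < N) :
    (2 : ℝ) ^ N.primeFactors.card < 11.25 * (N : ℝ) ^ ((1 : ℝ) / 5) := by
  have hN' : (0 : ℝ) < N := by exact_mod_cast hN
  have h : (32 : ℝ) ^ N.primeFactors.card * 200560490130 ≤ 32 ^ 11 * N := by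
    exact_mod_cast pow_card_primeFactors_mul_le hN
  have hroot : ((N : ℝ) ^ ((1 : ℝ) / 5)) ^ 5 = N := by
    rw [← Real.rpow_natCast, ← Real.rpow_mul hN'.le]
    norm_num
  refine lt_of_pow_lt_pow_left₀ 5 (by positivity) ?_
  rw [mul_pow, hroot, ← pow_mul, mul_comm _ 5, pow_mul]
  norm_num at h ⊢
  linarith
end

section
/- For every positive integer N not divisible by 5, 2^(ω(N)) < 7.77 · N^(1/5), where N^(1/5) denotes the real fifth root of N. -/
/-- If every element of `T` is at most `c` and every element of `S \ T` is at least `c`, then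
`T` minimizes `(∏ x ∈ S, x) / c ^ #S`. -/
theorem pow_card_mul_prod_le (c : ℕ) (S T : Finset ℕ) (hT : ∀ p ∈ T, p ≤ c)
    (hS : ∀ p ∈ S \ T, c ≤ p) :
    c ^ S.card * ∏ p ∈ T, p ≤ c ^ T.card * ∏ p ∈ S, p := by
  have h₁ : c ^ (S \ T).card ≤ ∏ p ∈ S \ T, p := Finset.pow_card_le_prod _ _ _ hS
  have h₂ : ∏ p ∈ T \ S, p ≤ c ^ (T \ S).card :=
    Finset.prod_le_pow_card _ _ _ fun p hp ↦ hT p (Finset.mem_sdiff.1 hp).1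
  rw [← Finset.card_inter_add_card_sdiff S T, ← Finset.card_inter_add_card_sdiff T S,
    ← Finset.prod_inter_mul_prod_sdiff S T, ← Finset.prod_inter_mul_prod_sdiff T S,
    Finset.inter_comm T S, pow_add, pow_add]
  calc _ = (c ^ (S ∩ T).card * ∏ p ∈ S ∩ T, p) *
        (c ^ (S \ T).card * ∏ p ∈ T \ S, p) := by ring
    _ ≤ (c ^ (S ∩ T).card * ∏ p ∈ S ∩ T, p) *
        ((∏ p ∈ S \ T, p) * c ^ (T \ S).card) := by gcongr
    _ = _ := by ring

/-- The threshold `32 = 2 ^ 5` is where `2 / p ^ (1 / 5)` drops below `1`. -/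
theorem thirtyTwo_pow_omega_mul_le (N : ℕ) (hN : 0 < N) (h5 : ¬ (5 ∣ N)) :
    32 ^ N.primeFactors.card * 40112098026 ≤ 32 ^ 10 * N := by
  have h := pow_card_mul_prod_le 32 N.primeFactors {2, 3, 7, 11, 13, 17, 19, 23, 29, 31}
    (by decide) (by
      intro p hp
      rw [Finset.mem_sdiff, Nat.mem_primeFactors] at hp
      obtain ⟨⟨hp, hpN, -⟩, hpT⟩ := hp
      by_contra! hlt
      interval_cases p <;> first | exact h5 hpN | exact hpT (by decide) | (norm_num at hp))
  calc _ ≤ 32 ^ 10 * ∏ p ∈ N.primeFactors, p := by simpa using h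
    _ ≤ 32 ^ 10 * N := Nat.mul_le_mul_left _ (Nat.le_of_dvd hN (Nat.prod_primeFactors_dvd N))

theorem two_pow_omega_lt_of_five_not_dvd (N : ℕ) (hN : 0 < N) (h5 : ¬ (5 ∣ N)) :
    (2 : ℝ) ^ N.primeFactors.card < 7.77 * (N : ℝ) ^ ((1 : ℝ) / 5) := by
  have h : (32 : ℝ) ^ N.primeFactors.card * 40112098026 ≤ 32 ^ 10 * N :=
    mod_cast thirtyTwo_pow_omega_mul_le N hN h5
  have hN' : (0 : ℝ) < N := mod_cast hN
  have hroot : ((N : ℝ) ^ ((1 : ℝ) / 5)) ^ 5 = N := by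
    rw [← Real.rpow_natCast, ← Real.rpow_mul hN'.le]
    norm_num
  refine lt_of_pow_lt_pow_left₀ 5 (by positivity) ?_
  rw [mul_pow, hroot, ← pow_mul, mul_comm _ 5, pow_mul]
  norm_num at h ⊢
  linarith
end
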